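/- Let R_i be a partial row over m candidates, w a candidate, and suppose w does not appear among the locked entries of R_i and position 1 is locked (R_{i,1} ≠ null). Let R'_i be the partial row with R'_{i,1} = w and R'_{i,k} = R_{i,k} for all k ≠ 1 (so the candidate previously locked at position 1 becomes free). Then Δ(R'_i) > Δ(R_i) and |R'_i| = |R_i|. -/

import Mathlib

section Defs

variable {n m : ℕ} {C : Type*}

/-- A partial row (partial ballot): each candidate appears at most once. -/
def IsPartialRow (r : Fin m → Option C) : Prop :=
  ∀ ⦃k k' : Fin m⦄ ⦃c : C⦄, r k = some c → r k' = some c → k = k'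

/-- `q` is a completion of the partial row `r` (a bijection from positions to
candidates agreeing with `r` on all non-null entries). -/
def IsCompletion (r : Fin m → Option C) (q : Fin m ≃ C) : Prop :=
  ∀ ⦃k : Fin m⦄ ⦃c : C⦄, r k = some c → q k = c

/-- Number of non-null (locked) entries of a partial row. -/
def rowSize (r : Fin m → Option C) : ℕ :=
  (Finset.univ.filter fun k : Fin m => (r k).isSome).card

/-- A partial rank matrix: each candidate appears at most once in every row. -/
def IsPartialMat (R : Fin n → Fin m → Option C) : Prop :=
  ∀ i, IsPartialRow (R i)

/-- `Q` is a complete extension of the partial rank matrix `R`: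
each row of `Q` is a bijection from positions to candidates
agreeing with the corresponding row of `R` on all non-null entries. -/
def IsMatCompletion (R : Fin n → Fin m → Option C) (Q : Fin n → Fin m ≃ C) : Prop :=
  ∀ i, IsCompletion (R i) (Q i)

/-- Number of non-null (locked) entries of a partial rank matrix. -/
def matSize (R : Fin n → Fin m → Option C) : ℕ := ∑ i, rowSize (R i)

/-- `R ⊆ R'` : the partial rank matrix `R'` extends the partial rank matrix `R`. -/
def PExt (R R' : Fin n → Fin m → Option C) : Prop :=
  ∀ i k c, R i k = some c → R' i k = some c

/-- `w` is a necessary winner of the partial rank matrix `X` under voting rule `F`. -/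
def NecessaryWinner (F : (Fin n → Fin m ≃ C) → Set C)
    (X : Fin n → Fin m → Option C) (w : C) : Prop :=
  ∀ Q : Fin n → Fin m ≃ C, IsMatCompletion X Q → w ∈ F Q

/-- `R∖Y` : the partial rank matrix obtained from the complete rank matrix `R` by
erasing (making null) the entries locked in `Y`. -/
def matDiff (R : Fin n → Fin m ≃ C) (Y : Fin n → Fin m → Option C) :
    Fin n → Fin m → Option C :=
  fun i k => if (Y i k).isSome then none else some (R i k)

/-- Borda score of candidate `c` in the complete row `q` :
a candidate in position `k+1` (index `k`) scores `m - (k+1)`. -/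
def bordaRowScore (q : Fin m ≃ C) (c : C) : ℤ := (m : ℤ) - 1 - ((q.symm c : ℕ) : ℤ)

/-- Minimal Borda score of `c` over all completions of the partial row `r`. -/
noncomputable def rowSMin (r : Fin m → Option C) (c : C) : ℤ :=
  sInf {x : ℤ | ∃ q : Fin m ≃ C, IsCompletion r q ∧ bordaRowScore q c = x}

/-- Maximal Borda score of `c` over all completions of the partial row `r`. -/
noncomputable def rowSMax (r : Fin m → Option C) (c : C) : ℤ :=
  sSup {x : ℤ | ∃ q : Fin m ≃ C, IsCompletion r q ∧ bordaRowScore q c = x}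

/-- Total score margin `Δ(r) = Σ_{c' ≠ w} (σmin_r(w) − σmax_r(c'))` of `w` in the
partial row `r`, under Borda weights. -/
noncomputable def rowDelta [Fintype C] [DecidableEq C]
    (r : Fin m → Option C) (w : C) : ℤ :=
  ∑ c ∈ Finset.univ.filter (fun c : C => c ≠ w), (rowSMin r w - rowSMax r c)

/-- Borda score of candidate `c` in the complete rank matrix `Q`. -/
def bordaScore (Q : Fin n → Fin m ≃ C) (c : C) : ℤ := ∑ i, bordaRowScore (Q i) c

/-- `w ∈ Borda(Q)` : `w` has maximal Borda score in the complete rank matrix `Q`. -/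
def IsBordaWinner (Q : Fin n → Fin m ≃ C) (w : C) : Prop :=
  ∀ c, bordaScore Q c ≤ bordaScore Q w

/-- Score of candidate `c` in the complete rank matrix `Q` under the scoring rule
with weight vector `wt`. -/
def scoreW (wt : Fin m → ℝ) (Q : Fin n → Fin m ≃ C) (c : C) : ℝ :=
  ∑ i, wt ((Q i).symm c)

/-- `σmin_R(c)` : minimal score of `c` over all complete extensions of `R`. -/
noncomputable def matSMinW (wt : Fin m → ℝ) (R : Fin n → Fin m → Option C) (c : C) : ℝ :=
  sInf {x : ℝ | ∃ Q : Fin n → Fin m ≃ C, IsMatCompletion R Q ∧ scoreW wt Q c = x}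

/-- `σmax_R(c)` : maximal score of `c` over all complete extensions of `R`. -/
noncomputable def matSMaxW (wt : Fin m → ℝ) (R : Fin n → Fin m → Option C) (c : C) : ℝ :=
  sSup {x : ℝ | ∃ Q : Fin n → Fin m ≃ C, IsMatCompletion R Q ∧ scoreW wt Q c = x}

/-- `σmin_{R_i}(c)` : minimal score of `c` over all completions of the single row `r`. -/
noncomputable def rowSMinW (wt : Fin m → ℝ) (r : Fin m → Option C) (c : C) : ℝ :=
  sInf {x : ℝ | ∃ q : Fin m ≃ C, IsCompletion r q ∧ wt (q.symm c) = x}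

/-- `σmax_{R_i}(c)` : maximal score of `c` over all completions of the single row `r`. -/
noncomputable def rowSMaxW (wt : Fin m → ℝ) (r : Fin m → Option C) (c : C) : ℝ :=
  sSup {x : ℝ | ∃ q : Fin m ≃ C, IsCompletion r q ∧ wt (q.symm c) = x}

/-- `r` is in normal form of parameters `k1, k2`: a position `p = k+1` is null
exactly when `k1 < p < m + 1 - k2`. -/
def IsNormalForm (r : Fin m → Option C) (k1 k2 : ℕ) : Prop :=
  ∀ k : Fin m, r k = none ↔ (k1 < (k : ℕ) + 1 ∧ (k : ℕ) + 1 < m + 1 - k2)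

end Defs

theorem IsPartialRow.exists_isCompletion {m : ℕ} {C : Type*} [Fintype C] [DecidableEq C]
    (hC : Fintype.card C = m) {r : Fin m → Option C} (hr : IsPartialRow r) (d : C) :
    ∃ q : Fin m ≃ C, IsCompletion r q := by
  obtain ⟨g, hg⟩ := Finset.exists_equiv_extend_of_card_eq (α := Fin m) (t := Finset.univ)
    (by simp [hC]) (s := Finset.univ.filter fun k => (r k).isSome)
    (f := fun k => (r k).getD d) (Finset.subset_univ _) (by
      intro k hk k' hk' h
      simp only [Finset.coe_filter, Finset.mem_univ, true_and, Set.mem_ofPred_eq,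
        Option.isSome_iff_exists] at hk hk'
      obtain ⟨c, hc⟩ := hk
      obtain ⟨c', hc'⟩ := hk'
      simp only [hc, hc', Option.getD_some] at h
      subst h
      exact hr hc hc')
  refine ⟨g.trans (Equiv.subtypeUnivEquiv fun c => Finset.mem_univ c), fun k c h => ?_⟩
  simpa [h] using hg k (by simp [h])

theorem bordaRowScore_le {m : ℕ} {C : Type*} (q : Fin m ≃ C) (c : C) :
    bordaRowScore q c ≤ m - 1 := by
  unfold bordaRowScore
  omega

theorem bordaRowScore_nonneg {m : ℕ} {C : Type*} (q : Fin m ≃ C) (c : C) :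
    0 ≤ bordaRowScore q c := by
  have := (q.symm c).isLt
  unfold bordaRowScore
  omega

theorem rowSMin_le {m : ℕ} {C : Type*} {r : Fin m → Option C} {q : Fin m ≃ C}
    (hq : IsCompletion r q) (c : C) : rowSMin r c ≤ bordaRowScore q c :=
  csInf_le ⟨0, by rintro _ ⟨q, -, rfl⟩; exact bordaRowScore_nonneg q c⟩ ⟨q, hq, rfl⟩

theorem le_rowSMax {m : ℕ} {C : Type*} {r : Fin m → Option C} {q : Fin m ≃ C}
    (hq : IsCompletion r q) (c : C) : bordaRowScore q c ≤ rowSMax r c :=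
  le_csSup ⟨m - 1, by rintro _ ⟨q, -, rfl⟩; exact bordaRowScore_le q c⟩ ⟨q, hq, rfl⟩

/-- Exchanging the candidate locked at position `p` with the unlocked candidate `w` turns
completions of `r` into completions of the row with `w` locked at `p` instead. -/
theorem IsCompletion.trans_swap {m : ℕ} {C : Type*} [DecidableEq C] {r : Fin m → Option C}
    (hr : IsPartialRow r) {a w : C} (hw : ∀ k, r k ≠ some w) {p : Fin m} (ha : r p = some a)
    {q : Fin m ≃ C} (hq : IsCompletion r q) :
    IsCompletion (fun k => if k = p then some w else r k) (q.trans (Equiv.swap a w)) := by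
  intro k c h
  by_cases hk : k = p
  · subst hk
    simp only [if_true, Option.some.injEq] at h
    simp [hq ha, h]
  · simp only [hk, if_false] at h
    have hca : c ≠ a := fun e => hk (hr h (e ▸ ha))
    have hcw : c ≠ w := fun e => hw k (e ▸ h)
    simp [hq h, Equiv.swap_apply_of_ne_of_ne hca hcw]

/-- Converse of `IsCompletion.trans_swap`. -/
theorem IsCompletion.of_update_trans_swap {m : ℕ} {C : Type*} [DecidableEq C]
    {r : Fin m → Option C} (hr : IsPartialRow r) {a w : C} (hw : ∀ k, r k ≠ some w)
    {p : Fin m} (ha : r p = some a) {q : Fin m ≃ C}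
    (hq : IsCompletion (fun k => if k = p then some w else r k) q) :
    IsCompletion r (q.trans (Equiv.swap a w)) := by
  intro k c h
  by_cases hk : k = p
  · subst hk
    have hqk : q k = w := hq (by simp)
    have hac : a = c := Option.some.inj (ha.symm.trans h)
    simp [hqk, hac]
  · have hqk : q k = c := hq (by simp [hk, h])
    have hca : c ≠ a := fun e => hk (hr h (e ▸ ha))
    have hcw : c ≠ w := fun e => hw k (e ▸ h)
    simp [hqk, Equiv.swap_apply_of_ne_of_ne hca hcw]

/- STATEMENT 9 -/
theorem stmt9 {m : ℕ} {C : Type*} [Fintype C] [DecidableEq C]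
    (hm : 2 ≤ m) (hC : Fintype.card C = m)
    (r : Fin m → Option C) (hr : IsPartialRow r) (w : C)
    (hw : ∀ k : Fin m, r k ≠ some w)
    (h1 : r ⟨0, by omega⟩ ≠ none) :
    rowDelta (fun k : Fin m => if k = ⟨0, by omega⟩ then some w else r k) w
      > rowDelta r w ∧
    rowSize (fun k : Fin m => if k = ⟨0, by omega⟩ then some w else r k) = rowSize r := by
  obtain ⟨a, ha⟩ := Option.ne_none_iff_exists'.mp h1
  generalize hp : (⟨0, by omega⟩ : Fin m) = p at *
  have hp0 : (p : ℕ) = 0 := by simp [← hp]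
  have haw : a ≠ w := fun e => hw p (e ▸ ha)
  obtain ⟨q, hq⟩ := hr.exists_isCompletion hC w
  have hq' := hq.trans_swap hr hw ha
  constructor
  · have hmin : rowSMin r w < rowSMin (fun k => if k = p then some w else r k) w := by
      refine lt_of_lt_of_le (b := (m : ℤ) - 1) ?_ (le_csInf ⟨_, _, hq', rfl⟩ ?_)
      · refine (rowSMin_le hq w).trans_lt ?_
        have hne : q.symm w ≠ p := fun e =>
          haw ((hq ha).symm.trans ((Equiv.symm_apply_eq q).mp e).symm)
        have hpos : ((q.symm w : Fin m) : ℕ) ≠ 0 := fun e => hne (Fin.ext (e.trans hp0.symm))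
        unfold bordaRowScore
        omega
      · rintro _ ⟨s, hs, rfl⟩
        have hsp : s.symm w = p := (Equiv.symm_apply_eq s).mpr (hs (k := p) (by simp)).symm
        simp [bordaRowScore, hsp, hp0]
    have hmax : ∀ c ≠ w, rowSMax (fun k => if k = p then some w else r k) c ≤ rowSMax r c := by
      intro c hcw
      refine csSup_le ⟨_, _, hq', rfl⟩ ?_
      rintro _ ⟨s, hs, rfl⟩
      have ht := hs.of_update_trans_swap hr hw ha
      refine le_trans ?_ (le_rowSMax ht c)
      by_cases hca : c = a
      · have hsp : s.symm w = p := (Equiv.symm_apply_eq s).mpr (hs (k := p) (by simp)).symm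
        have htop : bordaRowScore (s.trans (Equiv.swap a w)) a = (m : ℤ) - 1 := by
          simp [bordaRowScore, hsp, hp0]
        rw [hca, htop]
        exact bordaRowScore_le s a
      · simp [bordaRowScore, Equiv.swap_apply_of_ne_of_ne hca hcw]
    refine Finset.sum_lt_sum_of_nonempty ⟨a, by simp [haw]⟩ fun c hc => ?_
    have := hmax c (Finset.mem_filter.mp hc).2
    omega
  · unfold rowSize
    congr 1
    ext k
    by_cases hk : k = p <;> simp [hk, ha]
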